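/- Under Assumptions 1 and 2, there exists a constant C > 0 such that for every integer m ≥ 1 and every n ≥ 1, E[|Z_n|^m] ≤ (C·√m)^m. -/

import Mathlib

open MeasureTheory ProbabilityTheory Filter Real Set

/-- A real random variable has sub-Gaussian tails. -/
def SubGaussianTail {Ω : Type*} [MeasurableSpace Ω] (P : Measure Ω) (W : Ω → ℝ) : Prop :=
  ∃ C > 0, ∃ c > 0, ∀ t > 0,
    P {ω | t ≤ |W ω|} ≤ ENNReal.ofReal (C * Real.exp (-c * t ^ 2))

/-- A real random variable has sub-exponential tails. -/
def SubExponentialTail {Ω : Type*} [MeasurableSpace Ω] (P : Measure Ω) (W : Ω → ℝ) : Prop :=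
  ∃ C > 0, ∃ c > 0, ∀ t > 0,
    P {ω | t ≤ |W ω|} ≤ ENNReal.ofReal (C * Real.exp (-c * t))


lemma aux_exp_of_tail {Ω : Type*} [MeasurableSpace Ω] (P : Measure Ω) [IsProbabilityMeasure P]
    (W : Ω → ℝ) (hW : AEMeasurable W P) (h : SubExponentialTail P W) :
    ∃ t > 0, Integrable (fun ω => Real.exp (t * |W ω|)) P := by
  obtain ⟨C, hC, c, hc, ht⟩ := h
  refine ⟨c / 2, by positivity, ?_⟩
  have hm : AEMeasurable (fun ω => Real.exp (c / 2 * |W ω|)) P := by fun_prop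
  refine ⟨hm.aestronglyMeasurable, ?_⟩
  rw [hasFiniteIntegral_iff_ofReal (Eventually.of_forall fun ω => (Real.exp_pos _).le)]
  have hns : ∀ k : ℕ, NullMeasurableSet {ω | (k : ℝ) ≤ |W ω|} P := fun k =>
    nullMeasurableSet_le aemeasurable_const hW.abs
  have key : ∀ ω, ENNReal.ofReal (Real.exp (c / 2 * |W ω|)) ≤
      ∑' k : ℕ, ({ω | (k : ℝ) ≤ |W ω|}.indicator
        (fun _ => ENNReal.ofReal (Real.exp (c / 2 * (k + 1)))) ω) := by
    intro ω
    refine le_trans ?_ (ENNReal.le_tsum ⌊|W ω|⌋₊)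
    have h1 : ω ∈ {ω' | ((⌊|W ω|⌋₊ : ℕ) : ℝ) ≤ |W ω'|} := by
      rw [Set.mem_ofPred_eq]; exact Nat.floor_le (abs_nonneg _)
    rw [Set.indicator_of_mem h1]
    apply ENNReal.ofReal_le_ofReal
    apply Real.exp_le_exp.2
    have := (Nat.lt_floor_add_one |W ω|).le
    gcongr
  have hterm : ∀ k : ℕ, ∫⁻ ω, ({ω | (k : ℝ) ≤ |W ω|}.indicator
        (fun _ => ENNReal.ofReal (Real.exp (c / 2 * (k + 1)))) ω) ∂P ≤
        ENNReal.ofReal (((C + 1) * Real.exp (c / 2)) * (Real.exp (-(c / 2))) ^ k) := by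
    intro k
    rw [lintegral_indicator_const₀ (hns k)]
    have hP : P {ω | (k : ℝ) ≤ |W ω|} ≤ ENNReal.ofReal ((C + 1) * Real.exp (-c * k)) := by
      rcases Nat.eq_zero_or_pos k with rfl | hk
      · refine prob_le_one.trans ?_
        rw [← ENNReal.ofReal_one]
        apply ENNReal.ofReal_le_ofReal
        simp
        linarith
      · refine (ht k (by exact_mod_cast hk)).trans ?_
        apply ENNReal.ofReal_le_ofReal
        gcongr
        linarith
    calc _ ≤ ENNReal.ofReal (Real.exp (c / 2 * (k + 1))) *
          ENNReal.ofReal ((C + 1) * Real.exp (-c * k)) := by gcongr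
      _ = _ := by
        rw [← ENNReal.ofReal_mul (Real.exp_pos _).le]
        congr 1
        rw [← Real.exp_nat_mul]
        have : Real.exp (c / 2 * (k + 1)) * Real.exp (-c * k)
          = Real.exp (c / 2) * Real.exp (k * -(c / 2)) := by
          rw [← Real.exp_add, ← Real.exp_add]; congr 1; ring
        linear_combination (C + 1) * this
  have hsum : Summable (fun k : ℕ => ((C + 1) * Real.exp (c / 2)) * (Real.exp (-(c / 2))) ^ k) := by
    apply Summable.mul_left
    apply summable_geometric_of_lt_one (Real.exp_pos _).le
    rw [Real.exp_lt_one_iff]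
    linarith
  calc _ ≤ ∫⁻ ω, ∑' k : ℕ, ({ω | (k : ℝ) ≤ |W ω|}.indicator
        (fun _ => ENNReal.ofReal (Real.exp (c / 2 * (k + 1)))) ω) ∂P := lintegral_mono key
    _ = ∑' k : ℕ, ∫⁻ ω, ({ω | (k : ℝ) ≤ |W ω|}.indicator
        (fun _ => ENNReal.ofReal (Real.exp (c / 2 * (k + 1)))) ω) ∂P :=
        lintegral_tsum fun k => aemeasurable_const.indicator₀ (hns k)
    _ ≤ ∑' k : ℕ, ENNReal.ofReal (((C + 1) * Real.exp (c / 2)) * (Real.exp (-(c / 2))) ^ k) :=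
        ENNReal.tsum_le_tsum hterm
    _ < ⊤ := by
        rw [← ENNReal.ofReal_tsum_of_nonneg (fun k => by positivity) hsum]
        exact ENNReal.ofReal_lt_top

lemma aux_subE_of_subG {Ω : Type*} [MeasurableSpace Ω] (P : Measure Ω)
    (W : Ω → ℝ) (h : SubGaussianTail P W) : SubExponentialTail P (fun ω => W ω ^ 2) := by
  obtain ⟨C, hC, c, hc, ht⟩ := h
  refine ⟨C, hC, c, hc, fun t htp => ?_⟩
  have := ht (√t) (Real.sqrt_pos.2 htp)
  rw [Real.sq_sqrt htp.le] at this
  refine le_trans (measure_mono ?_) this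
  intro ω hω
  simp only [Set.mem_ofPred_eq] at hω ⊢
  rw [abs_of_nonneg (sq_nonneg _), ← sq_abs] at hω
  exact Real.sqrt_le_iff.2 ⟨abs_nonneg _, hω⟩ 

/-- one-sided Chernoff bound -/
lemma aux_chernoff {𝓧 Ω : Type*} [MeasurableSpace 𝓧] [MeasurableSpace Ω]
    (P : Measure Ω) [IsProbabilityMeasure P] (ν : Measure 𝓧) [IsProbabilityMeasure ν]
    (X : ℕ → Ω → 𝓧) (hX : ∀ i, Measurable (X i)) (hind : iIndepFun X P)
    (hlaw : ∀ i, Measure.map (X i) P = ν) (Y : 𝓧 → ℝ) (hY : AEMeasurable Y ν)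
    (hexp : ∃ t > 0, Integrable (fun x => Real.exp (t * |Y x|)) ν) (a : ℝ)
    (ha : ∫ x, Y x ∂ν < a) :
    ∃ c > 0, ∀ n : ℕ, P.real {ω | n * a ≤ ∑ i ∈ Finset.range n, Y (X i ω)} ≤
      Real.exp (-c * n) := by
  obtain ⟨t, ht, hti⟩ := hexp
  have hint : ∀ u, |u| ≤ t → Integrable (fun x => Real.exp (u * Y x)) ν := by
    intro u hu
    refine hti.mono' (by fun_prop) (Eventually.of_forall fun x => ?_)
    rw [Real.norm_of_nonneg (Real.exp_pos _).le]
    apply Real.exp_le_exp.2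
    calc u * Y x ≤ |u * Y x| := le_abs_self _
      _ = |u| * |Y x| := abs_mul _ _
      _ ≤ _ := by gcongr
  have h0 : (0 : ℝ) ∈ interior (integrableExpSet Y ν) := by
    rw [mem_interior_iff_mem_nhds]
    filter_upwards [Metric.ball_mem_nhds (0 : ℝ) ht] with u hu
    apply hint
    simpa using (Metric.mem_ball.1 hu).le
  have hd : HasDerivAt (mgf Y ν) (∫ x, Y x ∂ν) 0 := by
    have := hasDerivAt_mgf h0
    simpa using this
  have hd2 : HasDerivAt (fun u => Real.exp (-u * a) * mgf Y ν u) (∫ x, Y x ∂ν - a) 0 := by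
    have h1 : HasDerivAt (fun u : ℝ => Real.exp (-u * a)) (Real.exp (-0 * a) * (-1 * a)) 0 :=
      (((hasDerivAt_id (0 : ℝ)).neg).mul_const a).exp
    refine (h1.mul hd).congr_deriv ?_
    rw [mgf_zero]
    simp
    ring
  have hs := hd2.tendsto_slope_zero_right
  have hneg : ∀ᶠ u in nhdsWithin (0 : ℝ) (Set.Ioi 0), u⁻¹ • (Real.exp (-(0 + u) * a) * mgf Y ν (0 + u) -
      Real.exp (-0 * a) * mgf Y ν 0) < 0 := hs.eventually_lt_const (by linarith)
  obtain ⟨u, hu1, hu2⟩ := (hneg.and (Ioo_mem_nhdsGT ht)).exists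
  have hu0 := hu2.1
  have hui := hint u (by rw [abs_of_pos hu0]; exact hu2.2.le)
  set g := Real.exp (-u * a) * mgf Y ν u with hg
  have hgpos : 0 < g := mul_pos (Real.exp_pos _) (mgf_pos hui)
  have hg1 : g < 1 := by
    simp only [zero_add, neg_zero, zero_mul, Real.exp_zero, mgf_zero, smul_eq_mul, mul_one] at hu1
    have : g - 1 < 0 := by
      by_contra hcon
      push Not at hcon
      have : 0 ≤ u⁻¹ * (g - 1) := by positivity
      linarith
    linarith
  refine ⟨-Real.log g, by have := Real.log_neg hgpos hg1; linarith, fun n => ?_⟩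
  have hmg : ∀ i, mgf (Y ∘ X i) P u = mgf Y ν u := by
    intro i
    rw [← hlaw i, mgf_map (hX i).aemeasurable]
    rw [hlaw i]; fun_prop
  have hYX : ∀ i, AEMeasurable (Y ∘ X i) P := fun i =>
    (show AEMeasurable Y (Measure.map (X i) P) by rw [hlaw i]; exact hY).comp_measurable (hX i)
  have hindY : iIndepFun (fun i => Y ∘ X i) P :=
    hind.comp₀ (fun _ => Y) (fun i => (hX i).aemeasurable) (fun i => by rw [hlaw i]; exact hY)
  have hsum : mgf (∑ i ∈ Finset.range n, Y ∘ X i) P u = (mgf Y ν u) ^ n := by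
    rw [hindY.mgf_sum₀ hYX]
    simp [hmg]
  have hI : Integrable (fun ω => Real.exp (u * (∑ i ∈ Finset.range n, Y ∘ X i) ω)) P := by
    rw [← mgf_pos_iff, hsum]
    exact pow_pos (mgf_pos hui) n
  have := measure_ge_le_exp_mul_mgf (n * a) hu0.le hI
  simp only [Finset.sum_apply, Function.comp] at this
  refine this.trans (le_of_eq ?_)
  rw [hsum, neg_neg, mul_comm (Real.log g), Real.exp_nat_mul, Real.exp_log hgpos, hg, mul_pow,
    ← Real.exp_nat_mul]
  congr 2
  ring

lemma aux_exp_bound (x : ℝ) : Real.exp x ≤ 1 + x + x ^ 2 * Real.exp |x| := by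
  rcases le_or_gt |x| 1 with h | h
  · have h1 := (abs_le.1 (Real.abs_exp_sub_one_sub_id_le h)).2
    have h2 : (1 : ℝ) ≤ Real.exp |x| := Real.one_le_exp (abs_nonneg _)
    nlinarith [sq_nonneg x]
  · have h3 : 1 ≤ x ^ 2 := by rw [← sq_abs]; nlinarith
    have h2 : |x| + 1 ≤ Real.exp |x| := Real.add_one_le_exp _
    rcases le_or_gt 0 x with hx | hx
    · rw [abs_of_nonneg hx] at *
      nlinarith [Real.exp_pos x]
    · rw [abs_of_neg hx] at *
      have h4 : Real.exp x ≤ 1 := Real.exp_le_one_iff.2 hx.le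
      nlinarith [Real.exp_pos (-x)]

lemma aux_subG {𝓧 : Type*} [MeasurableSpace 𝓧] (ν : Measure 𝓧) [IsProbabilityMeasure ν]
    (Y : 𝓧 → ℝ) (hY : AEMeasurable Y ν) (c : ℝ) (hc : 0 < c)
    (hexp : Integrable (fun x => Real.exp (c * Y x ^ 2)) ν) (hYi : Integrable Y ν)
    (h0 : ∫ x, Y x ∂ν = 0) : ∃ σ, HasSubgaussianMGF Y σ ν := by
  have hpt : ∀ l x, Real.exp (l * Y x) ≤ Real.exp (l ^ 2 / (4 * c)) * Real.exp (c * Y x ^ 2) := by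
    intro l x
    rw [← Real.exp_add]
    apply Real.exp_le_exp.2
    have : l ^ 2 / (4 * c) + c * Y x ^ 2 - l * Y x = c * (Y x - l / (2 * c)) ^ 2 := by
      field_simp; ring
    have : 0 ≤ c * (Y x - l / (2 * c)) ^ 2 := by positivity
    linarith
  have hint : ∀ l, Integrable (fun x => Real.exp (l * Y x)) ν := by
    intro l
    refine (hexp.const_mul (Real.exp (l ^ 2 / (4 * c)))).mono' (by fun_prop)
      (Eventually.of_forall fun x => ?_)
    rw [Real.norm_of_nonneg (Real.exp_pos _).le]
    exact hpt l x
  set A := ∫ x, Real.exp (c * Y x ^ 2) ∂ν with hA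
  have hA0 : 0 ≤ A := integral_nonneg fun x => (Real.exp_pos _).le
  set K := (2 / c) * Real.exp (c / 4) * A with hK
  have hK0 : 0 ≤ K := by positivity
  have hσ : 0 ≤ 2 * (K + 1 / (4 * c) + 4 * A / c ^ 2) := by positivity
  refine ⟨⟨_, hσ⟩, hint, fun l => ?_⟩
  have hgoal : mgf Y ν l ≤ Real.exp ((K + 1 / (4 * c) + 4 * A / c ^ 2) * l ^ 2) := by
    rcases le_or_gt |l| (c / 2) with hl | hl
    · have hb : ∀ x, Real.exp (l * Y x) ≤ 1 + l * Y x +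
          l ^ 2 * ((2 / c) * Real.exp (c / 4) * Real.exp (c * Y x ^ 2)) := by
        intro x
        have h1 := aux_exp_bound (l * Y x)
        have h2 : Y x ^ 2 ≤ (2 / c) * Real.exp (c / 2 * Y x ^ 2) := by
          have := Real.add_one_le_exp (c / 2 * Y x ^ 2)
          calc Y x ^ 2 = (2 / c) * (c / 2 * Y x ^ 2) := by field_simp
            _ ≤ _ := by gcongr; linarith
        have h3 : Real.exp |l * Y x| ≤ Real.exp (c / 4) * Real.exp (c / 2 * Y x ^ 2) := by
          rw [← Real.exp_add]
          apply Real.exp_le_exp.2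
          rw [abs_mul]
          have : |l| * |Y x| ≤ c / 2 * |Y x| := by gcongr
          have h5 : |Y x| ≤ (1 + Y x ^ 2) / 2 := by
            rw [← sq_abs (Y x)]; nlinarith [sq_nonneg (|Y x| - 1)]
          have : c / 2 * |Y x| ≤ c / 2 * ((1 + Y x ^ 2) / 2) := by gcongr
          nlinarith [mul_nonneg hc.le (sq_nonneg (Y x))]
        have h4 : Y x ^ 2 * Real.exp |l * Y x| ≤
            (2 / c) * Real.exp (c / 4) * Real.exp (c * Y x ^ 2) := by
          calc _ ≤ ((2 / c) * Real.exp (c / 2 * Y x ^ 2)) *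
                (Real.exp (c / 4) * Real.exp (c / 2 * Y x ^ 2)) := by gcongr
            _ = (2 / c) * Real.exp (c / 4) *
              (Real.exp (c / 2 * Y x ^ 2) * Real.exp (c / 2 * Y x ^ 2)) := by ring
            _ = _ := by rw [← Real.exp_add]; congr 2; ring
        have h6 := mul_le_mul_of_nonneg_left h4 (sq_nonneg l)
        calc _ ≤ _ := h1
          _ = 1 + l * Y x + l ^ 2 * (Y x ^ 2 * Real.exp |l * Y x|) := by ring
          _ ≤ _ := by linarith
      have hi1 : Integrable (fun x => 1 + l * Y x) ν :=
        (integrable_const 1).add (hYi.const_mul l)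
      have hi2 : Integrable (fun x =>
          l ^ 2 * ((2 / c) * Real.exp (c / 4) * Real.exp (c * Y x ^ 2))) ν :=
        (hexp.const_mul _).const_mul _
      have h7 : mgf Y ν l ≤ 1 + K * l ^ 2 := by
        calc mgf Y ν l ≤ ∫ x, (1 + l * Y x +
              l ^ 2 * ((2 / c) * Real.exp (c / 4) * Real.exp (c * Y x ^ 2))) ∂ν :=
              integral_mono (hint l) (hi1.add hi2) hb
          _ = _ := by
            rw [integral_add hi1 hi2, integral_add (integrable_const 1) (hYi.const_mul l),
              integral_const_mul, integral_const_mul, integral_const_mul, h0]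
            simp [hK, hA]; ring
      refine h7.trans ?_
      have := Real.add_one_le_exp ((K + 1 / (4 * c) + 4 * A / c ^ 2) * l ^ 2)
      have h8 : 0 ≤ (1 / (4 * c) + 4 * A / c ^ 2) * l ^ 2 := by positivity
      linarith
    · have h1 : mgf Y ν l ≤ Real.exp (l ^ 2 / (4 * c)) * A := by
        rw [hA, ← integral_const_mul]
        exact integral_mono (hint l) (hexp.const_mul _) (hpt l)
      refine h1.trans ?_
      have h2 : A ≤ Real.exp A := by linarith [Real.add_one_le_exp A]
      calc _ ≤ Real.exp (l ^ 2 / (4 * c)) * Real.exp A := by gcongr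
        _ ≤ _ := by
          rw [← Real.exp_add]
          apply Real.exp_le_exp.2
          have h3 : c ^ 2 / 4 ≤ l ^ 2 := by rw [← sq_abs l]; nlinarith
          have h4 : A ≤ 4 * A / c ^ 2 * l ^ 2 := by
            calc A = 4 * A / c ^ 2 * (c ^ 2 / 4) := by field_simp
              _ ≤ _ := by gcongr
          have h5 : l ^ 2 / (4 * c) = 1 / (4 * c) * l ^ 2 := by ring
          have h6 : 0 ≤ K * l ^ 2 := by positivity
          nlinarith
  refine hgoal.trans (le_of_eq ?_)
  congr 1
  change (K + 1 / (4 * c) + 4 * A / c ^ 2) * l ^ 2 =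
    (2 * (K + 1 / (4 * c) + 4 * A / c ^ 2)) * l ^ 2 / 2
  ring

lemma aux_moment {𝓧 Ω : Type*} [MeasurableSpace 𝓧] [MeasurableSpace Ω]
    (P : Measure Ω) [IsProbabilityMeasure P] (ν : Measure 𝓧) [IsProbabilityMeasure ν]
    (X : ℕ → Ω → 𝓧) (hX : ∀ i, Measurable (X i)) (hind : iIndepFun X P)
    (hlaw : ∀ i, Measure.map (X i) P = ν) (Y : 𝓧 → ℝ) (hY : AEMeasurable Y ν)
    (σ : NNReal) (hsub : HasSubgaussianMGF Y σ ν) (m n : ℕ) (hm : 1 ≤ m) (hn : 1 ≤ n) :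
    Integrable (fun ω => (|∑ i ∈ Finset.range n, Y (X i ω)| / √n) ^ m) P ∧
    ∫ ω, (|∑ i ∈ Finset.range n, Y (X i ω)| / √n) ^ m ∂P ≤
      2 * (√m * Real.exp (σ / 2)) ^ m := by
  have hindY : iIndepFun (fun i => Y ∘ X i) P :=
    hind.comp₀ (fun _ => Y) (fun i => (hX i).aemeasurable) (fun i => by rw [hlaw i]; exact hY)
  have hYX : ∀ i, AEMeasurable (Y ∘ X i) P := fun i =>
    (show AEMeasurable Y (Measure.map (X i) P) by rw [hlaw i]; exact hY).comp_measurable (hX i)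
  have hs : ∀ i, HasSubgaussianMGF (Y ∘ X i) σ P := fun i =>
    HasSubgaussianMGF.of_map (hX i).aemeasurable (by rw [hlaw i]; exact hsub)
  have hS := HasSubgaussianMGF.sum_of_iIndepFun hindY (c := fun _ => σ) (s := Finset.range n)
    (fun i _ => hs i)
  simp only [Finset.sum_const, Finset.card_range, Function.comp] at hS
  set S : Ω → ℝ := fun ω => ∑ i ∈ Finset.range n, Y (X i ω) with hSdef
  have hnp : (0 : ℝ) < n := by exact_mod_cast hn
  have hmp : (0 : ℝ) < m := by exact_mod_cast hm
  have hsn : 0 < √(n : ℝ) := Real.sqrt_pos.2 hnp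
  have hsm : 0 < √(m : ℝ) := Real.sqrt_pos.2 hmp
  have hSm : AEMeasurable S P := hS.aemeasurable
  set l := √(m : ℝ) / √n with hl
  have hl0 : 0 < l := by positivity
  have hl2 : l ^ 2 = m / n := by
    rw [hl, div_pow, Real.sq_sqrt hnp.le, Real.sq_sqrt hmp.le]
  have hb : ∀ ω, (|S ω| / √n) ^ m ≤ √m ^ m * (Real.exp (l * S ω) + Real.exp (-l * S ω)) := by
    intro ω
    have h1 : (l * |S ω|) ^ m ≤ m.factorial * Real.exp (l * |S ω|) := by
      have := Real.pow_div_factorial_le_exp (l * |S ω|) (by positivity) m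
      rw [div_le_iff₀ (by positivity)] at this
      linarith
    have h2 : (m.factorial : ℝ) ≤ (m : ℝ) ^ m := by exact_mod_cast Nat.factorial_le_pow m
    have h3 : Real.exp (l * |S ω|) ≤ Real.exp (l * S ω) + Real.exp (-l * S ω) := by
      rcases abs_cases (S ω) with ⟨h, _⟩ | ⟨h, _⟩
      · rw [h]; linarith [Real.exp_pos (-l * S ω)]
      · rw [h, mul_neg, ← neg_mul]; linarith [Real.exp_pos (l * S ω)]
    have h4 : (|S ω| / √n) ^ m = (l * |S ω|) ^ m / √m ^ m := by
      rw [← div_pow]; congr 1; rw [hl]; field_simp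
    rw [h4, div_le_iff₀ (by positivity)]
    have h5 : (m : ℝ) ^ m = √m ^ m * √m ^ m := by
      rw [← mul_pow, Real.mul_self_sqrt hmp.le]
    calc _ ≤ (m.factorial : ℝ) * Real.exp (l * |S ω|) := h1
      _ ≤ (m : ℝ) ^ m * (Real.exp (l * S ω) + Real.exp (-l * S ω)) := by gcongr
      _ = _ := by rw [h5]; ring
  have hI : Integrable (fun ω => √m ^ m * (Real.exp (l * S ω) + Real.exp (-l * S ω))) P :=
    ((hS.integrable_exp_mul l).add (hS.integrable_exp_mul (-l))).const_mul _
  have hI2 : Integrable (fun ω => (|S ω| / √n) ^ m) P := by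
    refine hI.mono' (by fun_prop) (Eventually.of_forall fun ω => ?_)
    rw [Real.norm_of_nonneg (by positivity)]
    exact hb ω
  refine ⟨hI2, ?_⟩
  calc _ ≤ ∫ ω, √m ^ m * (Real.exp (l * S ω) + Real.exp (-l * S ω)) ∂P :=
        integral_mono hI2 hI hb
    _ = √m ^ m * (mgf S P l + mgf S P (-l)) := by
        rw [integral_const_mul, integral_add (hS.integrable_exp_mul l)
          (hS.integrable_exp_mul (-l))]
        rfl
    _ ≤ √m ^ m * (Real.exp (σ / 2 * m) + Real.exp (σ / 2 * m)) := by
        have e : ∀ u : ℝ, u ^ 2 = m / n → mgf S P u ≤ Real.exp (σ / 2 * m) := by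
          intro u hu
          refine (hS.mgf_le u).trans (le_of_eq ?_)
          rw [hu]
          congr 1
          simp
          field_simp
        gcongr
        · exact e l hl2
        · exact e (-l) (by rw [neg_sq]; exact hl2)
    _ = _ := by
        rw [mul_pow, ← Real.exp_nat_mul, mul_comm (σ / 2 : ℝ)]
        ring

lemma aux_envelope {𝓧 T : Type*} [MeasurableSpace 𝓧] (ν : Measure 𝓧)
    [TopologicalSpace T] [TopologicalSpace.SeparableSpace T] [Nonempty T]
    (g : T → 𝓧 → ℝ) (hg : ∀ t, AEMeasurable (g t) ν) (H : 𝓧 → ℝ)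
    (hcont : ∀ᵐ x ∂ν, Continuous fun t => g t x) (hle : ∀ᵐ x ∂ν, ∀ t, g t x ≤ H x) :
    ∃ G : 𝓧 → ℝ, AEMeasurable G ν ∧ (∀ᵐ x ∂ν, G x ≤ H x) ∧ ∀ᵐ x ∂ν, ∀ t, g t x ≤ G x := by
  refine ⟨fun x => ⨆ n : ℕ, g (TopologicalSpace.denseSeq T n) x,
    AEMeasurable.iSup fun n => hg _, ?_, ?_⟩
  · filter_upwards [hle] with x hx
    exact ciSup_le fun n => hx _
  · filter_upwards [hle, hcont] with x hx hc t
    have hbdd : BddAbove (Set.range fun n : ℕ => g (TopologicalSpace.denseSeq T n) x) :=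
      ⟨H x, by rintro _ ⟨n, rfl⟩; exact hx _⟩
    refine (TopologicalSpace.denseRange_denseSeq T).induction_on
      (p := fun t => g t x ≤ ⨆ n : ℕ, g (TopologicalSpace.denseSeq T n) x) t
      (isClosed_le hc continuous_const) fun n => ?_
    exact le_ciSup hbdd n


lemma aux_sq_to_abs {𝓧 : Type*} [MeasurableSpace 𝓧] (ν : Measure 𝓧)
    (Y : 𝓧 → ℝ) (hY : AEMeasurable Y ν) (c : ℝ) (hc : 0 < c)
    (hexp : Integrable (fun x => Real.exp (c * Y x ^ 2)) ν) (t : ℝ) :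
    Integrable (fun x => Real.exp (t * |Y x|)) ν := by
  refine (hexp.const_mul (Real.exp (t ^ 2 / (4 * c)))).mono' (by fun_prop)
    (Eventually.of_forall fun x => ?_)
  rw [Real.norm_of_nonneg (Real.exp_pos _).le, ← Real.exp_add]
  apply Real.exp_le_exp.2
  have h1 : t ^ 2 / (4 * c) + c * |Y x| ^ 2 - t * |Y x| = c * (|Y x| - t / (2 * c)) ^ 2 := by
    field_simp; ring
  have h2 : 0 ≤ c * (|Y x| - t / (2 * c)) ^ 2 := by positivity
  rw [sq_abs] at h1
  linarith

lemma aux_integrable_of_exp {𝓧 : Type*} [MeasurableSpace 𝓧] (ν : Measure 𝓧)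
    (Y : 𝓧 → ℝ) (hY : AEMeasurable Y ν) (t : ℝ) (ht : 0 < t)
    (hexp : Integrable (fun x => Real.exp (t * |Y x|)) ν) : Integrable Y ν := by
  refine (hexp.const_mul (1 / t)).mono' hY.aestronglyMeasurable
    (Eventually.of_forall fun x => ?_)
  rw [Real.norm_eq_abs, one_div, ← div_eq_inv_mul, le_div_iff₀ ht]
  linarith [Real.add_one_le_exp (t * |Y x|)]

lemma aux_taylor (φ : ℝ → ℝ) (θ₀ ρ h : ℝ) (hh : 0 ≤ h)
    (hd : ∀ t ∈ Metric.ball θ₀ ρ, DifferentiableAt ℝ φ t)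
    (hd2 : ∀ t ∈ Metric.ball θ₀ ρ, DifferentiableAt ℝ (deriv φ) t)
    (hlip : ∀ t ∈ Metric.ball θ₀ ρ, |deriv (deriv φ) θ₀ - deriv (deriv φ) t| ≤ h * |t - θ₀|) :
    ∀ t ∈ Metric.ball θ₀ ρ, |φ t - φ θ₀ - deriv φ θ₀ * (t - θ₀)
      - deriv (deriv φ) θ₀ * (t - θ₀) ^ 2 / 2| ≤ h * |t - θ₀| ^ 3 := by
  have hsub : ∀ t ∈ Metric.ball θ₀ ρ, ∀ u ∈ Metric.closedBall θ₀ |t - θ₀|,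
      u ∈ Metric.ball θ₀ ρ := by
    intro t ht u hu
    rw [Metric.mem_ball, Real.dist_eq] at *
    rw [Metric.mem_closedBall, Real.dist_eq] at hu
    linarith
  have step1 : ∀ t ∈ Metric.ball θ₀ ρ,
      |deriv φ t - deriv φ θ₀ - deriv (deriv φ) θ₀ * (t - θ₀)| ≤ h * |t - θ₀| ^ 2 := by
    intro t ht
    have := (convex_closedBall θ₀ |t - θ₀|).norm_image_sub_le_of_norm_hasDerivWithin_le
      (f := fun u => deriv φ u - deriv (deriv φ) θ₀ * (u - θ₀))
      (f' := fun u => deriv (deriv φ) u - deriv (deriv φ) θ₀ * 1) (C := h * |t - θ₀|)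
      (x := θ₀) (y := t)
      (fun u hu => ((hd2 u (hsub t ht u hu)).hasDerivAt.sub
        (((hasDerivAt_id u).sub_const θ₀).const_mul _)).hasDerivWithinAt)
      (fun u hu => by
        have h1 := hlip u (hsub t ht u hu)
        rw [Metric.mem_closedBall, Real.dist_eq] at hu
        rw [Real.norm_eq_abs, mul_one, abs_sub_comm]
        exact h1.trans (by gcongr))
      (by simp) (by simp [Real.dist_eq])
    simp only [Real.norm_eq_abs, sub_self, mul_zero, sub_zero] at this
    calc _ = |deriv φ t - deriv (deriv φ) θ₀ * (t - θ₀) - deriv φ θ₀| := by congr 1; ring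
      _ ≤ _ := this
      _ = _ := by ring
  intro t ht
  have := (convex_closedBall θ₀ |t - θ₀|).norm_image_sub_le_of_norm_hasDerivWithin_le
      (f := fun u => φ u - deriv φ θ₀ * (u - θ₀) - deriv (deriv φ) θ₀ / 2 * (u - θ₀) ^ 2)
      (f' := fun u => deriv φ u - deriv φ θ₀ * 1 - deriv (deriv φ) θ₀ / 2 *
        ((2 : ℕ) * (u - θ₀) ^ (2 - 1) * 1)) (C := h * |t - θ₀| ^ 2)
      (x := θ₀) (y := t)
      (fun u hu => (((hd u (hsub t ht u hu)).hasDerivAt.sub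
        (((hasDerivAt_id u).sub_const θ₀).const_mul _)).sub
        ((((hasDerivAt_id u).sub_const θ₀).pow 2).const_mul _)).hasDerivWithinAt)
      (fun u hu => by
        have h1 := step1 u (hsub t ht u hu)
        rw [Metric.mem_closedBall, Real.dist_eq] at hu
        rw [Real.norm_eq_abs]
        calc _ = |deriv φ u - deriv φ θ₀ - deriv (deriv φ) θ₀ * (u - θ₀)| := by
              congr 1; norm_num; ring
          _ ≤ _ := h1
          _ ≤ _ := by gcongr)
      (by simp) (by simp [Real.dist_eq])
  simp only [Real.norm_eq_abs, sub_self, mul_zero, sub_zero, ne_eq, OfNat.ofNat_ne_zero,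
    not_false_eq_true, zero_pow] at this
  calc _ = |φ t - deriv φ θ₀ * (t - θ₀) - deriv (deriv φ) θ₀ / 2 * (t - θ₀) ^ 2 - φ θ₀| := by
        congr 1; ring
    _ ≤ _ := this
    _ = _ := by ring

lemma aux_KL {𝓧 : Type*} [MeasurableSpace 𝓧] (μ : Measure 𝓧) (f0 f1 : 𝓧 → ℝ)
    (hm0 : Measurable f0) (h0 : ∀ x, 0 < f0 x) (h1 : ∀ x, 0 < f1 x)
    (hi0 : ∫ x, f0 x ∂μ = 1) (hi1 : ∫ x, f1 x ∂μ = 1)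
    (hint : Integrable (fun x => Real.log (f1 x) - Real.log (f0 x))
      (μ.withDensity fun x => ENNReal.ofReal (f0 x)))
    (hne : ¬ f1 =ᵐ[μ] f0) :
    ∫ x, (Real.log (f1 x) - Real.log (f0 x)) ∂(μ.withDensity fun x => ENNReal.ofReal (f0 x)) < 0 := by
  have hI0 : Integrable f0 μ := by
    by_contra h; rw [integral_undef h] at hi0; norm_num at hi0
  have hI1 : Integrable f1 μ := by
    by_contra h; rw [integral_undef h] at hi1; norm_num at hi1
  have hmm : Measurable fun x => ENNReal.ofReal (f0 x) := hm0.ennreal_ofReal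
  have htop : ∀ᵐ x ∂μ, ENNReal.ofReal (f0 x) < ⊤ := Eventually.of_forall fun x => ENNReal.ofReal_lt_top
  rw [integrable_withDensity_iff_integrable_smul' hmm htop] at hint
  rw [integral_withDensity_eq_integral_toReal_smul hmm htop]
  simp only [ENNReal.toReal_ofReal (h0 _).le, smul_eq_mul] at hint ⊢
  by_contra hcon
  push Not at hcon
  have hid : ∀ x, f1 x - f0 x - f0 x * (Real.log (f1 x) - Real.log (f0 x)) =
      f0 x * ((f1 x / f0 x - 1) - Real.log (f1 x / f0 x)) := by
    intro x
    rw [Real.log_div (h1 x).ne' (h0 x).ne']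
    have := (h0 x).ne'
    field_simp
  have hnn : 0 ≤ fun x => f1 x - f0 x - f0 x * (Real.log (f1 x) - Real.log (f0 x)) := by
    intro x
    simp only [Pi.zero_apply]
    rw [hid]
    refine mul_nonneg (h0 x).le ?_
    linarith [Real.log_le_sub_one_of_pos (div_pos (h1 x) (h0 x))]
  have hgi : Integrable (fun x => f1 x - f0 x - f0 x * (Real.log (f1 x) - Real.log (f0 x))) μ :=
    (hI1.sub hI0).sub hint
  have hz : ∫ x, (f1 x - f0 x - f0 x * (Real.log (f1 x) - Real.log (f0 x))) ∂μ = 0 := by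
    refine le_antisymm ?_ (integral_nonneg hnn)
    have e1 : ∫ x, (f1 x - f0 x - f0 x * (Real.log (f1 x) - Real.log (f0 x))) ∂μ =
        ∫ x, (f1 x - f0 x) ∂μ - ∫ x, f0 x * (Real.log (f1 x) - Real.log (f0 x)) ∂μ :=
      integral_sub (hI1.sub hI0) hint
    rw [e1, integral_sub hI1 hI0, hi0, hi1]
    linarith
  rw [integral_eq_zero_iff_of_nonneg hnn hgi] at hz
  apply hne
  filter_upwards [hz] with x hx
  by_contra hxx
  simp only [Pi.zero_apply] at hx
  rw [hid] at hx
  have : f1 x / f0 x ≠ 1 := fun h => hxx ((div_eq_one_iff_eq (h0 x).ne').1 h)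
  have := Real.log_lt_sub_one_of_pos (div_pos (h1 x) (h0 x)) this
  have : 0 < f0 x * ((f1 x / f0 x - 1) - Real.log (f1 x / f0 x)) :=
    mul_pos (h0 x) (by linarith)
  linarith

/-- exponentially small events -/
def AuxExpSmall {Ω : Type*} [MeasurableSpace Ω] (P : Measure Ω) (A : ℕ → Set Ω) : Prop :=
  ∃ D c : ℝ, 0 ≤ D ∧ 0 < c ∧ ∀ n : ℕ, 1 ≤ n → P.real (A n) ≤ D * Real.exp (-c * n)

lemma AuxExpSmall.union {Ω : Type*} [MeasurableSpace Ω] {P : Measure Ω} {A A' : ℕ → Set Ω}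
    (h : AuxExpSmall P A) (h' : AuxExpSmall P A') : AuxExpSmall P (fun n => A n ∪ A' n) := by
  obtain ⟨D, c, hD, hc, hb⟩ := h
  obtain ⟨D', c', hD', hc', hb'⟩ := h'
  refine ⟨D + D', min c c', by positivity, lt_min hc hc', fun n hn => ?_⟩
  have e1 : Real.exp (-c * n) ≤ Real.exp (-(min c c') * n) := by
    gcongr; exact min_le_left _ _
  have e2 : Real.exp (-c' * n) ≤ Real.exp (-(min c c') * n) := by
    gcongr; exact min_le_right _ _
  calc _ ≤ P.real (A n) + P.real (A' n) := measureReal_union_le _ _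
    _ ≤ D * Real.exp (-c * n) + D' * Real.exp (-c' * n) := add_le_add (hb n hn) (hb' n hn)
    _ ≤ D * Real.exp (-(min c c') * n) + D' * Real.exp (-(min c c') * n) := by gcongr
    _ = _ := by ring

lemma AuxExpSmall.mono {Ω : Type*} [MeasurableSpace Ω] {P : Measure Ω} [IsProbabilityMeasure P]
    {A A' : ℕ → Set Ω} (h : AuxExpSmall P A')
    (hs : ∀ n, 1 ≤ n → ∀ᵐ ω ∂P, ω ∈ A n → ω ∈ A' n) : AuxExpSmall P A := by
  obtain ⟨D, c, hD, hc, hb⟩ := h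
  refine ⟨D, c, hD, hc, fun n hn => le_trans ?_ (hb n hn)⟩
  exact ENNReal.toReal_mono (measure_ne_top _ _) (measure_mono_ae (hs n hn))

lemma aux_consistency {𝓧 Ω : Type*} [MeasurableSpace 𝓧] [MeasurableSpace Ω]
    (P : Measure Ω) [IsProbabilityMeasure P] (ν : Measure 𝓧) [IsProbabilityMeasure ν]
    (X : ℕ → Ω → 𝓧) (hX : ∀ i, Measurable (X i)) (hind : iIndepFun X P)
    (hlaw : ∀ i, Measure.map (X i) P = ν) (K : Set ℝ) (hK : IsCompact K) (θ₀ : ℝ) (hθ₀ : θ₀ ∈ K)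
    (L : ℝ → 𝓧 → ℝ) (hL : ∀ θ ∈ K, AEMeasurable (L θ) ν) (H : 𝓧 → ℝ) (hH : AEMeasurable H ν)
    (c : ℝ) (hc : 0 < c) (hexp : Integrable (fun x => Real.exp (c * H x ^ 2)) ν)
    (hlip : ∀ᵐ x ∂ν, ∀ θ ∈ K, ∀ θ' ∈ K, |L θ x - L θ' x| ≤ H x * |θ - θ'|)
    (hH0 : ∀ᵐ x ∂ν, 0 ≤ H x)
    (hKL : ∀ θ ∈ K, θ ≠ θ₀ → ∫ x, (L θ x - L θ₀ x) ∂ν < 0)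
    (θhat : ℕ → Ω → ℝ) (hmem : ∀ n ω, θhat n ω ∈ K)
    (hmax : ∀ (n : ℕ), 1 ≤ n → ∀ ω, ∑ i ∈ Finset.range n, L θ₀ (X i ω) ≤
      ∑ i ∈ Finset.range n, L (θhat n ω) (X i ω)) (ε : ℝ) (hε : 0 < ε) :
    AuxExpSmall P (fun n => {ω | ε ≤ |θhat n ω - θ₀|}) := by
  have hHi : Integrable H ν :=
    aux_integrable_of_exp ν H hH 1 one_pos (aux_sq_to_abs ν H hH c hc hexp 1)
  have hcpt : IsCompact (K ∩ {θ | ε ≤ |θ - θ₀|}) :=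
    hK.inter_right (isClosed_le continuous_const (by fun_prop))
  have main : AuxExpSmall P (fun n => {ω | θhat n ω ∈ K ∩ {θ | ε ≤ |θ - θ₀|}}) := by
    refine hcpt.induction_on (p := fun S => AuxExpSmall P (fun n => {ω | θhat n ω ∈ S}))
      ?_ ?_ ?_ ?_
    · exact ⟨0, 1, le_rfl, one_pos, fun n _ => by simp⟩
    · intro S S' hSS h
      exact h.mono fun n _ => Eventually.of_forall fun ω hω => by
        rw [Set.mem_ofPred_eq] at *
        exact hSS hω
    · intro S S' h h'
      exact (h.union h').mono fun n _ => Eventually.of_forall fun ω hω => hω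
    · rintro θ ⟨hθK, hθε⟩
      rw [Set.mem_ofPred_eq] at hθε
      have hne : θ ≠ θ₀ := by
        rintro rfl
        simp at hθε
        linarith
      have hM := hKL θ hθK hne
      set M := ∫ x, (L θ x - L θ₀ x) ∂ν with hMdef
      set δ := -M / (|∫ x, H x ∂ν| + 1) with hδ
      have hδ0 : 0 < δ := by
        have : 0 < |∫ x, H x ∂ν| + 1 := by positivity
        exact div_pos (by linarith) this
      have hδM : δ * ∫ x, H x ∂ν < -M := by
        have h1 : 0 < |∫ x, H x ∂ν| + 1 := by positivity
        have h2 : δ * (|∫ x, H x ∂ν| + 1) = -M := by rw [hδ]; field_simp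
        have h3 := le_abs_self (∫ x, H x ∂ν)
        nlinarith
      have hLd : AEMeasurable (fun x => L θ x - L θ₀ x) ν := (hL θ hθK).sub (hL θ₀ hθ₀)
      have hLi : Integrable (fun x => L θ x - L θ₀ x) ν := by
        refine (hHi.mul_const |θ - θ₀|).mono' hLd.aestronglyMeasurable ?_
        filter_upwards [hlip] with x hx
        exact hx θ hθK θ₀ hθ₀
      have hYm : AEMeasurable (fun x => (L θ x - L θ₀ x) + δ * H x) ν := hLd.add (hH.const_mul δ)
      have hYe : ∃ t > 0, Integrable (fun x => Real.exp (t * |(L θ x - L θ₀ x) + δ * H x|)) ν := by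
        refine ⟨1, one_pos, ?_⟩
        refine (aux_sq_to_abs ν H hH c hc hexp (|θ - θ₀| + δ)).mono' (by fun_prop) ?_
        filter_upwards [hlip, hH0] with x hx hx0
        rw [Real.norm_of_nonneg (Real.exp_pos _).le]
        apply Real.exp_le_exp.2
        have h1 := hx θ hθK θ₀ hθ₀
        rw [abs_of_nonneg hx0, one_mul]
        calc _ ≤ |L θ x - L θ₀ x| + |δ * H x| := abs_add_le _ _
          _ ≤ H x * |θ - θ₀| + δ * H x := by
            rw [abs_of_nonneg (by positivity : 0 ≤ δ * H x)]; linarith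
          _ = _ := by ring
      have hYmean : ∫ x, ((L θ x - L θ₀ x) + δ * H x) ∂ν < 0 := by
        rw [integral_add hLi (hHi.const_mul δ), integral_const_mul]
        linarith
      obtain ⟨c', hc', hb⟩ := aux_chernoff P ν X hX hind hlaw _ hYm hYe 0 hYmean
      refine ⟨Metric.ball θ δ, mem_nhdsWithin_of_mem_nhds (Metric.ball_mem_nhds θ hδ0), ?_⟩
      have hsm : AuxExpSmall P (fun n => {ω | n * (0 : ℝ) ≤ ∑ i ∈ Finset.range n,
          ((L θ (X i ω) - L θ₀ (X i ω)) + δ * H (X i ω))}) :=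
        ⟨1, c', zero_le_one, hc', fun n _ => by rw [one_mul]; exact hb n⟩
      refine hsm.mono fun n hn => ?_
      have hall : ∀ᵐ ω ∂P, ∀ i, (∀ θ ∈ K, ∀ θ' ∈ K, |L θ (X i ω) - L θ' (X i ω)| ≤
          H (X i ω) * |θ - θ'|) ∧ 0 ≤ H (X i ω) := by
        rw [ae_all_iff]
        intro i
        have h := hlip.and hH0
        rw [← hlaw i] at h
        exact ae_of_ae_map (hX i).aemeasurable h
      filter_upwards [hall] with ω hω hin
      replace hin : θhat n ω ∈ Metric.ball θ δ := hin
      rw [Metric.mem_ball, Real.dist_eq] at hin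
      rw [mul_zero]
      have h1 : ∑ i ∈ Finset.range n, (L (θhat n ω) (X i ω) - L θ₀ (X i ω)) ≤
          ∑ i ∈ Finset.range n, ((L θ (X i ω) - L θ₀ (X i ω)) + δ * H (X i ω)) := by
        refine Finset.sum_le_sum fun i _ => ?_
        have h2 := (le_abs_self _).trans ((hω i).1 _ (hmem n ω) θ hθK)
        have h3 := mul_le_mul_of_nonneg_left hin.le (hω i).2
        linarith
      have h4 := hmax n hn ω
      rw [Finset.sum_sub_distrib] at h1
      linarith
  exact main.mono fun n _ => Eventually.of_forall fun ω hω => by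
    rw [Set.mem_ofPred_eq] at *
    exact ⟨hmem n ω, hω⟩

lemma aux_pow_exp (m n : ℕ) (c : ℝ) (hc : 0 < c) :
    √(n : ℝ) ^ m * Real.exp (-c * n) ≤ (√m / √(2 * c)) ^ m := by
  rw [← pow_le_pow_iff_left₀ (by positivity) (by positivity) two_ne_zero]
  have h1 : (√(n : ℝ) ^ m * Real.exp (-c * n)) ^ 2 = (n : ℝ) ^ m * Real.exp (-(2 * c * n)) := by
    rw [mul_pow, ← pow_mul, mul_comm m 2, pow_mul, Real.sq_sqrt (by positivity),
      ← Real.exp_nat_mul]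
    congr 2
    push_cast; ring
  have h2 : ((√(m : ℝ) / √(2 * c)) ^ m) ^ 2 = (m : ℝ) ^ m / (2 * c) ^ m := by
    rw [← pow_mul, mul_comm m 2, pow_mul, div_pow, Real.sq_sqrt (by positivity),
      Real.sq_sqrt (by positivity), div_pow]
  rw [h1, h2, le_div_iff₀ (by positivity), Real.exp_neg]
  have h3 := Real.pow_div_factorial_le_exp (2 * c * n) (by positivity) m
  rw [div_le_iff₀ (by positivity)] at h3
  have h4 : (m.factorial : ℝ) ≤ (m : ℝ) ^ m := by exact_mod_cast Nat.factorial_le_pow m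
  have he := Real.exp_pos (2 * c * n)
  rw [show (n : ℝ) ^ m * (Real.exp (2 * c * n))⁻¹ * (2 * c) ^ m =
    (2 * c * n) ^ m / Real.exp (2 * c * n) by rw [mul_pow (2 * c)]; field_simp]
  rw [div_le_iff₀ he]
  nlinarith

lemma aux_final {Ω : Type*} [MeasurableSpace Ω] (P : Measure Ω) [IsProbabilityMeasure P]
    (Z S : ℕ → Ω → ℝ) (hZ : ∀ n, AEMeasurable (Z n) P) (A : ℕ → Set Ω) (hA : AuxExpSmall P A)
    (R a b : ℝ) (hR : 0 ≤ R) (ha : 0 ≤ a) (hb : 0 ≤ b) (hZR : ∀ n ω, |Z n ω| ≤ R * √n)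
    (hZS : ∀ n, 1 ≤ n → ∀ᵐ ω ∂P, ω ∉ A n → |Z n ω| ≤ a * (|S n ω| / √n))
    (hS : ∀ m n : ℕ, 1 ≤ m → 1 ≤ n → Integrable (fun ω => (|S n ω| / √n) ^ m) P ∧
      ∫ ω, (|S n ω| / √n) ^ m ∂P ≤ 2 * (√m * b) ^ m) :
    ∃ C > 0, ∀ m : ℕ, 1 ≤ m → ∀ n : ℕ, 1 ≤ n →
      ∫ ω, |Z n ω| ^ m ∂P ≤ (C * Real.sqrt m) ^ m := by
  obtain ⟨D, c, hD, hc, hAb⟩ := hA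
  refine ⟨(D + 2) * (R / √(2 * c) + a * b + 1), by positivity, fun m hm n hn => ?_⟩
  obtain ⟨hSi, hSb⟩ := hS m n hm hn
  set A' := toMeasurable P (A n) with hA'
  have hA'm : MeasurableSet A' := measurableSet_toMeasurable _ _
  have hA'P : P.real A' = P.real (A n) := by
    simp only [Measure.real, hA', measure_toMeasurable]
  have hZi : Integrable (fun ω => |Z n ω| ^ m) P := by
    refine Integrable.mono' (integrable_const ((R * √n) ^ m)) (by have := hZ n; fun_prop)
      (Eventually.of_forall fun ω => ?_)
    rw [Real.norm_of_nonneg (by positivity)]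
    exact pow_le_pow_left₀ (abs_nonneg _) (hZR n ω) m
  have hi1 : Integrable (A'.indicator fun _ => (R * √(n : ℝ)) ^ m) P :=
    (integrable_const _).indicator hA'm
  have hi2 : Integrable (fun ω => a ^ m * (|S n ω| / √n) ^ m) P := hSi.const_mul _
  have hpt : ∀ᵐ ω ∂P, |Z n ω| ^ m ≤ A'.indicator (fun _ => (R * √(n : ℝ)) ^ m) ω +
      a ^ m * (|S n ω| / √n) ^ m := by
    filter_upwards [hZS n hn] with ω hω
    by_cases h : ω ∈ A'
    · rw [Set.indicator_of_mem h]
      have h1 := pow_le_pow_left₀ (abs_nonneg _) (hZR n ω) m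
      have h2 : 0 ≤ a ^ m * (|S n ω| / √n) ^ m := by positivity
      linarith
    · rw [Set.indicator_of_notMem h, zero_add, ← mul_pow]
      exact pow_le_pow_left₀ (abs_nonneg _)
        (hω fun h' => h (subset_toMeasurable P (A n) h')) m
  have hx : D * (R / √(2 * c) * √m) ^ m + 2 * (a * b * √m) ^ m ≤
      ((D + 2) * (R / √(2 * c) + a * b + 1) * √m) ^ m := by
    have e1 : (R / √(2 * c) * √m) ^ m ≤ ((R / √(2 * c) + a * b + 1) * √m) ^ m := by
      have : 0 ≤ a * b := by positivity
      gcongr; linarith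
    have e2 : (a * b * √m) ^ m ≤ ((R / √(2 * c) + a * b + 1) * √m) ^ m := by
      have : 0 ≤ R / √(2 * c) := by positivity
      gcongr; linarith
    have e3 : D + 2 ≤ (D + 2) ^ m := le_self_pow₀ (by linarith) (by omega)
    rw [mul_assoc (D + 2), mul_pow (D + 2)]
    have e4 : 0 ≤ ((R / √(2 * c) + a * b + 1) * √m) ^ m := by positivity
    nlinarith
  refine le_trans ?_ hx
  calc _ ≤ ∫ ω, (A'.indicator (fun _ => (R * √(n : ℝ)) ^ m) ω +
        a ^ m * (|S n ω| / √n) ^ m) ∂P := integral_mono_ae hZi (hi1.add hi2) hpt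
    _ = P.real A' * (R * √n) ^ m + a ^ m * ∫ ω, (|S n ω| / √n) ^ m ∂P := by
        rw [integral_add hi1 hi2, integral_indicator_const _ hA'm, integral_const_mul, smul_eq_mul]
    _ ≤ (D * Real.exp (-c * n)) * (R * √n) ^ m + a ^ m * (2 * (√m * b) ^ m) := by
        rw [hA'P]
        have := hAb n hn
        gcongr
    _ = D * R ^ m * (√n ^ m * Real.exp (-c * n)) + 2 * (a * b * √m) ^ m := by
        rw [mul_pow, mul_pow, mul_pow, mul_pow]; ring
    _ ≤ D * R ^ m * (√m / √(2 * c)) ^ m + 2 * (a * b * √m) ^ m := by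
        gcongr
        exact aux_pow_exp m n c hc
    _ = _ := by
        rw [mul_assoc, ← mul_pow]; congr 3; ring


lemma aux_subG_mono {Ω : Type*} [MeasurableSpace Ω] (P : Measure Ω) (W W' : Ω → ℝ)
    (h : SubGaussianTail P W) (hle : ∀ᵐ ω ∂P, |W' ω| ≤ |W ω|) : SubGaussianTail P W' := by
  obtain ⟨C, hC, c, hc, ht⟩ := h
  refine ⟨C, hC, c, hc, fun t htp => le_trans (measure_mono_ae ?_) (ht t htp)⟩
  filter_upwards [hle] with ω hω h
  exact le_trans h hω

lemma aux_subE_mono {Ω : Type*} [MeasurableSpace Ω] (P : Measure Ω) (W W' : Ω → ℝ)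
    (h : SubExponentialTail P W) (hle : ∀ᵐ ω ∂P, |W' ω| ≤ |W ω|) : SubExponentialTail P W' := by
  obtain ⟨C, hC, c, hc, ht⟩ := h
  refine ⟨C, hC, c, hc, fun t htp => le_trans (measure_mono_ae ?_) (ht t htp)⟩
  filter_upwards [hle] with ω hω h
  exact le_trans h hω

lemma aux_exp_nu {𝓧 Ω : Type*} [MeasurableSpace 𝓧] [MeasurableSpace Ω]
    (P : Measure Ω) [IsProbabilityMeasure P] (ν : Measure 𝓧) (X : Ω → 𝓧) (hX : Measurable X)
    (hlaw : Measure.map X P = ν) (Y : 𝓧 → ℝ) (hY : AEMeasurable Y ν)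
    (h : SubExponentialTail P (fun ω => Y (X ω))) :
    ∃ t > 0, Integrable (fun x => Real.exp (t * |Y x|)) ν := by
  subst hlaw
  obtain ⟨t, ht, hi⟩ := aux_exp_of_tail P (fun ω => Y (X ω)) (hY.comp_measurable hX) h
  refine ⟨t, ht, ?_⟩
  rw [integrable_map_measure (by fun_prop) hX.aemeasurable]
  exact hi

/-- a measurable Lipschitz constant -/
lemma aux_lip_env {𝓧 : Type*} [MeasurableSpace 𝓧] (ν : Measure 𝓧) (K : Set ℝ)
    (a b : ℝ) (ha : a ∈ K) (hb : b ∈ K) (hab : a ≠ b)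
    (L : ℝ → 𝓧 → ℝ) (hL : ∀ θ ∈ K, AEMeasurable (L θ) ν)
    (hcont : ∀ᵐ x ∂ν, ContinuousOn (fun t => L t x) K)
    (H : 𝓧 → ℝ) (hlip : ∀ x, ∀ θ ∈ K, ∀ θ' ∈ K, |L θ x - L θ' x| ≤ H x * |θ - θ'|) :
    ∃ G : 𝓧 → ℝ, AEMeasurable G ν ∧ (∀ᵐ x ∂ν, 0 ≤ G x) ∧ (∀ᵐ x ∂ν, G x ≤ H x) ∧
      ∀ᵐ x ∂ν, ∀ θ ∈ K, ∀ θ' ∈ K, |L θ x - L θ' x| ≤ G x * |θ - θ'| := by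
  let T := {p : ℝ × ℝ // p.1 ∈ K ∧ p.2 ∈ K ∧ p.1 ≠ p.2}
  have : Nonempty T := ⟨⟨(a, b), ha, hb, hab⟩⟩
  have hpos : ∀ t : T, 0 < |t.1.1 - t.1.2| := fun t => abs_pos.2 (sub_ne_zero.2 t.2.2.2)
  obtain ⟨G, hGm, hGH, hG⟩ := aux_envelope (T := T) ν
    (fun t x => |L t.1.1 x - L t.1.2 x| / |t.1.1 - t.1.2|)
    (fun t => by
      have h1 := hL _ t.2.1
      have h2 := hL _ t.2.2.1
      fun_prop) H
    (by
      filter_upwards [hcont] with x hx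
      have h1 : Continuous fun t : T => L t.1.1 x :=
        hx.comp_continuous (by fun_prop) fun t => t.2.1
      have h2 : Continuous fun t : T => L t.1.2 x :=
        hx.comp_continuous (by fun_prop) fun t => t.2.2.1
      exact (h1.sub h2).abs.div (by fun_prop) fun t => (hpos t).ne')
    (Eventually.of_forall fun x t => by
      rw [div_le_iff₀ (hpos t)]
      exact hlip x _ t.2.1 _ t.2.2.1)
  refine ⟨G, hGm, ?_, hGH, ?_⟩
  · filter_upwards [hG] with x hx
    exact le_trans (by positivity) (hx ⟨(a, b), ha, hb, hab⟩)
  · filter_upwards [hG] with x hx θ hθ θ' hθ'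
    by_cases h : θ = θ'
    · simp [h]
    · have := hx ⟨(θ, θ'), hθ, hθ', h⟩
      rwa [div_le_iff₀ (hpos ⟨(θ, θ'), hθ, hθ', h⟩)] at this

/-- a measurable constant for the third order remainder -/
lemma aux_rem_env {𝓧 : Type*} [MeasurableSpace 𝓧] (ν : Measure 𝓧) (θ₀ ρ : ℝ) (hρ : 0 < ρ)
    (L : ℝ → 𝓧 → ℝ) (hL : ∀ θ ∈ Metric.ball θ₀ ρ, AEMeasurable (L θ) ν)
    (hcont : ∀ᵐ x ∂ν, ContinuousOn (fun t => L t x) (Metric.ball θ₀ ρ))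
    (S D H : 𝓧 → ℝ) (hS : AEMeasurable S ν) (hD : AEMeasurable D ν)
    (hrem : ∀ᵐ x ∂ν, ∀ t ∈ Metric.ball θ₀ ρ, |L t x - L θ₀ x - S x * (t - θ₀)
      - D x * (t - θ₀) ^ 2 / 2| ≤ H x * |t - θ₀| ^ 3) :
    ∃ G : 𝓧 → ℝ, AEMeasurable G ν ∧ (∀ᵐ x ∂ν, 0 ≤ G x) ∧ (∀ᵐ x ∂ν, G x ≤ H x) ∧
      ∀ᵐ x ∂ν, ∀ t ∈ Metric.ball θ₀ ρ, |L t x - L θ₀ x - S x * (t - θ₀)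
      - D x * (t - θ₀) ^ 2 / 2| ≤ G x * |t - θ₀| ^ 3 := by
  let T := {t : ℝ // t ∈ Metric.ball θ₀ ρ ∧ t ≠ θ₀}
  have hmem : θ₀ + ρ / 2 ∈ Metric.ball θ₀ ρ ∧ θ₀ + ρ / 2 ≠ θ₀ := by
    constructor
    · rw [Metric.mem_ball, Real.dist_eq, add_sub_cancel_left, abs_of_pos (by positivity)]
      linarith
    · linarith
  have : Nonempty T := ⟨⟨_, hmem⟩⟩
  have h00 : θ₀ ∈ Metric.ball θ₀ ρ := Metric.mem_ball_self hρ
  have hpos : ∀ t : T, 0 < |t.1 - θ₀| ^ 3 := fun t => by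
    have := abs_pos.2 (sub_ne_zero.2 t.2.2)
    positivity
  obtain ⟨G, hGm, hGH, hG⟩ := aux_envelope (T := T) ν
    (fun t x => |L t.1 x - L θ₀ x - S x * (t.1 - θ₀)
      - D x * (t.1 - θ₀) ^ 2 / 2| / |t.1 - θ₀| ^ 3)
    (fun t => by
      have h1 := hL _ t.2.1
      have h2 := hL _ h00
      fun_prop) H
    (by
      filter_upwards [hcont] with x hx
      have h1 : Continuous fun t : T => L t.1 x :=
        hx.comp_continuous (by fun_prop) fun t => t.2.1
      exact Continuous.div (((h1.sub continuous_const).sub (by fun_prop)).sub (by fun_prop)).abs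
        (by fun_prop) fun t => (hpos t).ne')
    (by
      filter_upwards [hrem] with x hx t
      rw [div_le_iff₀ (hpos t)]
      exact hx t.1 t.2.1)
  refine ⟨G, hGm, ?_, hGH, ?_⟩
  · filter_upwards [hG] with x hx
    exact le_trans (by positivity) (hx ⟨_, hmem⟩)
  · filter_upwards [hG] with x hx t ht
    by_cases h : t = θ₀
    · simp [h]
    · have := hx ⟨t, ht, h⟩
      rwa [div_le_iff₀ (hpos ⟨t, ht, h⟩)] at this

lemma aux_score_meas {𝓧 : Type*} [MeasurableSpace 𝓧] (ν : Measure 𝓧) (θ₀ ρ : ℝ) (hρ : 0 < ρ)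
    (L : ℝ → 𝓧 → ℝ) (hL : ∀ θ ∈ Metric.ball θ₀ ρ, AEMeasurable (L θ) ν)
    (hd : ∀ᵐ x ∂ν, DifferentiableAt ℝ (fun t => L t x) θ₀) :
    AEMeasurable (fun x => deriv (fun t => L t x) θ₀) ν := by
  have hu : Tendsto (fun k : ℕ => θ₀ + ρ / ((k : ℝ) + 2)) atTop (nhdsWithin θ₀ {θ₀}ᶜ) := by
    rw [tendsto_nhdsWithin_iff]
    constructor
    · have : Tendsto (fun k : ℕ => ρ / ((k : ℝ) + 2)) atTop (nhds 0) :=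
        Tendsto.div_atTop tendsto_const_nhds
          (tendsto_atTop_add_const_right _ _ tendsto_natCast_atTop_atTop)
      simpa using this.const_add θ₀
    · refine Eventually.of_forall fun k => ?_
      have : 0 < ρ / ((k : ℝ) + 2) := by positivity
      simp only [Set.mem_compl_iff, Set.mem_singleton_iff]
      linarith
  refine aemeasurable_of_tendsto_metrizable_ae atTop
    (f := fun (k : ℕ) x => slope (fun t => L t x) θ₀ (θ₀ + ρ / ((k : ℝ) + 2))) (fun k => ?_) ?_
  · have h1 : θ₀ + ρ / ((k : ℝ) + 2) ∈ Metric.ball θ₀ ρ := by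
      rw [Metric.mem_ball, Real.dist_eq, add_sub_cancel_left, abs_of_pos (by positivity),
        div_lt_iff₀ (by positivity)]
      have : (0 : ℝ) ≤ k := by positivity
      nlinarith
    have h2 := hL _ h1
    have h3 := hL _ (Metric.mem_ball_self hρ)
    simp only [slope_def_field]
    fun_prop
  · filter_upwards [hd] with x hx
    exact hx.hasDerivAt.tendsto_slope.comp hu

lemma aux_score_mean {𝓧 : Type*} [MeasurableSpace 𝓧] (ν : Measure 𝓧) (θ₀ ρ : ℝ) (hρ : 0 < ρ)
    (L : ℝ → 𝓧 → ℝ) (hL : ∀ θ ∈ Metric.ball θ₀ ρ, AEMeasurable (L θ) ν)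
    (hd : ∀ᵐ x ∂ν, DifferentiableAt ℝ (fun t => L t x) θ₀)
    (H : 𝓧 → ℝ) (hHi : Integrable H ν) (hH0 : ∀ᵐ x ∂ν, 0 ≤ H x)
    (hlip : ∀ᵐ x ∂ν, ∀ θ ∈ Metric.ball θ₀ ρ, ∀ θ' ∈ Metric.ball θ₀ ρ,
      |L θ x - L θ' x| ≤ H x * |θ - θ'|)
    (hKL : ∀ θ ∈ Metric.ball θ₀ ρ, θ ≠ θ₀ → ∫ x, (L θ x - L θ₀ x) ∂ν < 0) :
    Integrable (fun x => deriv (fun t => L t x) θ₀) ν ∧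
      ∫ x, deriv (fun t => L t x) θ₀ ∂ν = 0 := by
  have hball := Metric.ball_mem_nhds θ₀ hρ
  obtain ⟨h1, h2⟩ := hasDerivAt_integral_of_dominated_loc_of_lip (μ := ν) (𝕜 := ℝ)
    (F := fun t x => L t x - L θ₀ x) (F' := fun x => deriv (fun t => L t x) θ₀) (x₀ := θ₀)
    (bound := H) hball
    (by
      filter_upwards [hball] with t ht
      exact ((hL t ht).sub (hL _ (Metric.mem_ball_self hρ))).aestronglyMeasurable)
    (by simp)
    (aux_score_meas ν θ₀ ρ hρ L hL hd).aestronglyMeasurable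
    (by
      filter_upwards [hlip, hH0] with x hx hx0
      refine LipschitzOnWith.of_dist_le_mul fun u hu v hv => ?_
      rw [Real.dist_eq, Real.dist_eq, Real.coe_nnabs, abs_of_nonneg hx0, sub_sub_sub_cancel_right]
      exact hx u hu v hv)
    hHi
    (by
      filter_upwards [hd] with x hx
      exact hx.hasDerivAt.sub_const _)
  refine ⟨h1, ?_⟩
  refine IsLocalMax.hasDerivAt_eq_zero ?_ h2
  filter_upwards [hball] with t ht
  by_cases h : t = θ₀
  · rw [h]
  · simpa using (hKL t ht h).le


lemma aux_det (I n S D G Δ aG ε : ℝ) (hI : 0 < I) (hn : 0 < n) (haG : 0 < aG)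
    (hε : ε ≤ I / (8 * aG)) (h0 : 0 ≤ S * Δ + D * Δ ^ 2 / 2 + G * |Δ| ^ 3)
    (hD : D ≤ n * (-(I / 2))) (hG : G ≤ n * aG) (hΔ : |Δ| ≤ ε) :
    |√(I * n) * Δ| ≤ 8 / √I * (|S| / √n) := by
  have hd := abs_nonneg Δ
  have h1 : S * Δ ≤ |S| * |Δ| := by rw [← abs_mul]; exact le_abs_self _
  have h2 : D * Δ ^ 2 / 2 ≤ -(n * I / 4) * |Δ| ^ 2 := by
    rw [← sq_abs Δ]
    have := mul_le_mul_of_nonneg_right hD (sq_nonneg |Δ|)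
    linarith
  have h3 : G * |Δ| ^ 3 ≤ n * I / 8 * |Δ| ^ 2 := by
    have e1 : aG * |Δ| ≤ I / 8 := by
      have := mul_le_mul_of_nonneg_left (hΔ.trans hε) haG.le
      have e : aG * (I / (8 * aG)) = I / 8 := by field_simp
      linarith
    have e2 : G * |Δ| ^ 3 ≤ n * aG * |Δ| ^ 3 := mul_le_mul_of_nonneg_right hG (by positivity)
    have e3 : n * |Δ| ^ 2 * (aG * |Δ|) ≤ n * |Δ| ^ 2 * (I / 8) :=
      mul_le_mul_of_nonneg_left e1 (by positivity)
    calc _ ≤ _ := e2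
      _ = n * |Δ| ^ 2 * (aG * |Δ|) := by ring
      _ ≤ _ := e3
      _ = _ := by ring
  have h4 : n * I * |Δ| ≤ 8 * |S| := by
    rcases hd.eq_or_lt with h | h
    · rw [← h, mul_zero]; positivity
    · have : (n * I * |Δ|) * |Δ| ≤ (8 * |S|) * |Δ| := by nlinarith
      exact le_of_mul_le_mul_right this h
  rw [abs_mul, abs_of_nonneg (Real.sqrt_nonneg _), Real.sqrt_mul hI.le, div_mul_div_comm,
    le_div_iff₀ (by positivity)]
  calc _ = (√I * √I) * (√n * √n) * |Δ| := by ring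
    _ = n * I * |Δ| := by rw [Real.mul_self_sqrt hI.le, Real.mul_self_sqrt hn.le]; ring
    _ ≤ _ := h4

lemma aux_deriv_bound (φ : ℝ → ℝ) (θ₀ ρ h : ℝ) (hρ : 0 < ρ) (hh : 0 ≤ h)
    (hlip : ∀ t ∈ Metric.ball θ₀ ρ, |φ t - φ θ₀| ≤ h * |t - θ₀|) : |deriv φ θ₀| ≤ h := by
  rw [← Real.norm_eq_abs]
  refine norm_deriv_le_of_lip' hh ?_
  filter_upwards [Metric.ball_mem_nhds θ₀ hρ] with t ht
  exact hlip t ht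


theorem stmt2
    -- the sample space with a σ-finite base measure
    {𝓧 : Type*} [MeasurableSpace 𝓧] (μ : Measure 𝓧) [SigmaFinite μ]
    -- the parameter set: open, with compact closure K bounded by B
    (Θ : Set ℝ) (hΘopen : IsOpen Θ) (K : Set ℝ) (hK : K = closure Θ)
    (hKcpt : IsCompact K) (B : ℝ) (hB : ∀ θ ∈ K, |θ| ≤ B)
    -- the statistical model: positive densities, measurable, integrating to one
    (f : ℝ → 𝓧 → ℝ)
    (hf_pos : ∀ θ ∈ K, ∀ x, 0 < f θ x)
    (hf_meas : ∀ θ ∈ K, Measurable (f θ))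
    (hf_prob : ∀ θ ∈ K, ∫ x, f θ x ∂μ = 1)
    -- a.e. smoothness: θ ↦ log f(x|θ) is twice differentiable on Θ, continuous on K
    (hf_smooth : ∀ᵐ x ∂μ,
      (∀ θ ∈ Θ, DifferentiableAt ℝ (fun t => Real.log (f t x)) θ) ∧
      (∀ θ ∈ Θ, DifferentiableAt ℝ (deriv (fun t => Real.log (f t x))) θ) ∧
      ContinuousOn (fun t => Real.log (f t x)) K)
    -- identifiability
    (hident : ∀ θ ∈ K, ∀ θ' ∈ K, f θ =ᵐ[μ] f θ' → θ = θ')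
    -- the true parameter
    (θ₀ : ℝ) (hθ₀ : θ₀ ∈ Θ)
    -- the score function
    (s : ℝ → 𝓧 → ℝ) (hs : ∀ θ x, s θ x = deriv (fun t => Real.log (f t x)) θ)
    -- the Fisher information at θ₀: finite and strictly positive
    (IFi : ℝ) (hIFi_int : Integrable (fun x => deriv (fun t => s t x) θ₀ * f θ₀ x) μ)
    (hIFi : IFi = -∫ x, deriv (fun t => s t x) θ₀ * f θ₀ x ∂μ) (hIFi_pos : 0 < IFi)
    -- the i.i.d. samples X₁, X₂, … with density f(·|θ₀)
    {Ω : Type*} [MeasurableSpace Ω] (P : Measure Ω) [IsProbabilityMeasure P]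
    (X : ℕ → Ω → 𝓧) (hX_meas : ∀ i, Measurable (X i))
    (hX_indep : iIndepFun X P)
    (hX_law : ∀ i, Measure.map (X i) P = μ.withDensity (fun x => ENNReal.ofReal (f θ₀ x)))
    -- the maximum likelihood estimator θ̂ₙ, a measurable maximizer of Lₙ over K
    (θhat : ℕ → Ω → ℝ) (hθhat_meas : ∀ n, Measurable (θhat n))
    (hθhat_mem : ∀ (n : ℕ) (ω : Ω), θhat n ω ∈ K)
    (hθhat_max : ∀ (n : ℕ) (ω : Ω), ∀ θ ∈ K,
      (1 / (n : ℝ)) * ∑ i ∈ Finset.range n, Real.log (f θ (X i ω)) ≤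
      (1 / (n : ℝ)) * ∑ i ∈ Finset.range n, Real.log (f (θhat n ω) (X i ω)))
    -- Assumption 1: sub-Gaussian Lipschitz envelope for the log-likelihood
    (H : 𝓧 → ℝ) (hH_nonneg : ∀ x, 0 ≤ H x)
    (hH_lip : ∀ x, ∀ θ ∈ K, ∀ θ' ∈ K,
      |Real.log (f θ x) - Real.log (f θ' x)| ≤ H x * |θ - θ'|)
    (hH_subG : SubGaussianTail P (fun ω => H (X 0 ω)))
    -- Assumption 2: sub-exponential control of the score derivative
    (Hbar : 𝓧 → ℝ) (hHbar_nonneg : ∀ x, 0 ≤ Hbar x)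
    (hHbar_lip : ∀ x, ∀ θ ∈ K,
      |deriv (fun t => s t x) θ₀ - deriv (fun t => s t x) θ| ≤ Hbar x * |θ - θ₀|)
    (hscore_subE : SubExponentialTail P (fun ω => deriv (fun t => s t (X 0 ω)) θ₀))
    (hHbar_subE : SubExponentialTail P (fun ω => Hbar (X 0 ω)))
    -- the normalized estimation error
    (Z : ℕ → Ω → ℝ)
    (hZ : ∀ (n : ℕ) (ω : Ω), Z n ω = Real.sqrt (IFi * n) * (θhat n ω - θ₀)) :
    -- STATEMENT: uniform sub-Gaussian moment growth for Z_n
    ∃ C > 0, ∀ m : ℕ, 1 ≤ m → ∀ n : ℕ, 1 ≤ n →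
      ∫ ω, |Z n ω| ^ m ∂P ≤ (C * Real.sqrt m) ^ m := by
  set ν : Measure 𝓧 := μ.withDensity (fun x => ENNReal.ofReal (f θ₀ x)) with hν
  have hΘK : Θ ⊆ K := by rw [hK]; exact subset_closure
  have hθ₀K : θ₀ ∈ K := hΘK hθ₀
  have hνP : IsProbabilityMeasure ν := by
    rw [← hX_law 0]
    exact Measure.isProbabilityMeasure_map (hX_meas 0).aemeasurable
  have hac : ν ≪ μ := withDensity_absolutelyContinuous _ _
  have hsfun : ∀ x, (fun t => s t x) = deriv (fun t => Real.log (f t x)) := fun x =>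
    funext fun t => hs t x
  have hXae : ∀ p : 𝓧 → Prop, (∀ᵐ x ∂ν, p x) → ∀ i, ∀ᵐ ω ∂P, p (X i ω) := by
    intro p hp i
    rw [← hX_law i] at hp
    exact ae_of_ae_map (hX_meas i).aemeasurable hp
  have hsm := hac.ae_le hf_smooth
  obtain ⟨ρ, hρ, hball⟩ := Metric.isOpen_iff.1 hΘopen θ₀ hθ₀
  have hballK : Metric.ball θ₀ ρ ⊆ K := hball.trans hΘK
  have h00 : θ₀ ∈ Metric.ball θ₀ ρ := Metric.mem_ball_self hρ
  have hLm : ∀ θ ∈ K, AEMeasurable (fun x => Real.log (f θ x)) ν := fun θ hθ =>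
    (hf_meas θ hθ).log.aemeasurable
  -- the measurable Lipschitz envelope
  have hbmem : θ₀ + ρ / 2 ∈ K := by
    apply hballK
    rw [Metric.mem_ball, Real.dist_eq, add_sub_cancel_left, abs_of_pos (by positivity)]
    linarith
  obtain ⟨H', hH'm, hH'0, hH'H, hH'lip⟩ := aux_lip_env ν K θ₀ (θ₀ + ρ / 2) hθ₀K hbmem
    (by linarith) (fun θ x => Real.log (f θ x)) hLm
    (by filter_upwards [hsm] with x hx; exact hx.2.2) H hH_lip
  have hH'G : SubGaussianTail P (fun ω => H' (X 0 ω)) := by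
    refine aux_subG_mono P _ _ hH_subG ?_
    filter_upwards [hXae _ hH'0 0, hXae _ hH'H 0] with ω h1 h2
    rw [abs_of_nonneg h1, abs_of_nonneg (hH_nonneg _)]
    exact h2
  obtain ⟨c, hc, hcexp'⟩ := aux_exp_nu P ν (X 0) (hX_meas 0) (hX_law 0) (fun x => H' x ^ 2)
    (by fun_prop) (aux_subE_of_subG P _ hH'G)
  have hcexp : Integrable (fun x => Real.exp (c * H' x ^ 2)) ν := by
    refine hcexp'.congr (Eventually.of_forall fun x => ?_)
    simp only [abs_of_nonneg (sq_nonneg (H' x))]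
  have hH'i : Integrable H' ν :=
    aux_integrable_of_exp ν H' hH'm 1 one_pos (aux_sq_to_abs ν H' hH'm c hc hcexp 1)
  -- Kullback-Leibler
  have hKL : ∀ θ ∈ K, θ ≠ θ₀ → ∫ x, (Real.log (f θ x) - Real.log (f θ₀ x)) ∂ν < 0 := by
    intro θ hθ hne
    refine aux_KL μ (f θ₀) (f θ) (hf_meas _ hθ₀K) (hf_pos _ hθ₀K) (hf_pos _ hθ)
      (hf_prob _ hθ₀K) (hf_prob _ hθ) ?_ (fun h => hne (hident θ hθ θ₀ hθ₀K h))
    refine (hH'i.mul_const |θ - θ₀|).mono'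
      ((hLm θ hθ).sub (hLm θ₀ hθ₀K)).aestronglyMeasurable ?_
    filter_upwards [hH'lip] with x hx
    exact hx θ hθ θ₀ hθ₀K
  -- the score
  have hd0 : ∀ᵐ x ∂ν, DifferentiableAt ℝ (fun t => Real.log (f t x)) θ₀ := by
    filter_upwards [hsm] with x hx
    exact hx.1 θ₀ hθ₀
  have hLmb : ∀ θ ∈ Metric.ball θ₀ ρ, AEMeasurable (fun x => Real.log (f θ x)) ν :=
    fun θ hθ => hLm θ (hballK hθ)
  obtain ⟨S0, hS0⟩ : ∃ S0 : 𝓧 → ℝ, S0 = fun x => deriv (fun t => Real.log (f t x)) θ₀ := ⟨_, rfl⟩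
  have hS0m : AEMeasurable S0 ν := by
    rw [hS0]
    exact aux_score_meas ν θ₀ ρ hρ (fun θ x => Real.log (f θ x)) hLmb hd0
  have hS0i : Integrable S0 ν ∧ ∫ x, S0 x ∂ν = 0 := by
    rw [hS0]
    exact aux_score_mean ν θ₀ ρ hρ (fun θ x => Real.log (f θ x)) hLmb hd0 H' hH'i hH'0
      (by
        filter_upwards [hH'lip] with x hx θ hθ θ' hθ'
        exact hx θ (hballK hθ) θ' (hballK hθ'))
      (fun θ hθ => hKL θ (hballK hθ))
  have hS0b : ∀ᵐ x ∂ν, |S0 x| ≤ H' x := by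
    filter_upwards [hH'lip, hH'0] with x hx hx0
    rw [hS0]
    exact aux_deriv_bound _ θ₀ ρ (H' x) hρ hx0 fun t ht => hx t (hballK ht) θ₀ hθ₀K
  have hS0exp : Integrable (fun x => Real.exp (c * S0 x ^ 2)) ν := by
    refine hcexp.mono' (by fun_prop) ?_
    filter_upwards [hS0b] with x hx
    rw [Real.norm_of_nonneg (Real.exp_pos _).le, ← sq_abs]
    have := pow_le_pow_left₀ (abs_nonneg _) hx 2
    exact Real.exp_le_exp.2 (mul_le_mul_of_nonneg_left this hc.le)
  obtain ⟨σ, hσ⟩ := aux_subG ν S0 hS0m c hc hS0exp hS0i.1 hS0i.2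
  -- the second derivative
  obtain ⟨D2, hD2⟩ : ∃ D2 : 𝓧 → ℝ, D2 = fun x => deriv (fun t => s t x) θ₀ := ⟨_, rfl⟩
  have hD2x : ∀ x, deriv (fun t => s t x) θ₀ = D2 x := fun x => by rw [hD2]
  simp only [hD2x] at hIFi_int hIFi hHbar_lip hscore_subE
  have hf0m := hf_meas θ₀ hθ₀K
  have hf0p := hf_pos θ₀ hθ₀K
  have hD2mμ : AEMeasurable D2 μ := by
    have h1 : AEMeasurable (fun x => D2 x * f θ₀ x / f θ₀ x) μ :=
      hIFi_int.aestronglyMeasurable.aemeasurable.div hf0m.aemeasurable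
    refine h1.congr (Eventually.of_forall fun x => ?_)
    have := (hf0p x).ne'
    simp only
    field_simp
  have hD2m : AEMeasurable D2 ν := hD2mμ.mono_ac hac
  have hD2e := aux_exp_nu P ν (X 0) (hX_meas 0) (hX_law 0) D2 hD2m hscore_subE
  have hD2int : ∫ x, D2 x ∂ν = -IFi := by
    rw [hν, integral_withDensity_eq_integral_toReal_smul hf0m.ennreal_ofReal
      (Eventually.of_forall fun x => ENNReal.ofReal_lt_top), hIFi, neg_neg]
    refine integral_congr_ae (Eventually.of_forall fun x => ?_)
    simp only [ENNReal.toReal_ofReal (hf0p x).le, smul_eq_mul]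
    ring
  obtain ⟨c1, hc1, hch1⟩ := aux_chernoff P ν X hX_meas hX_indep hX_law D2 hD2m hD2e (-(IFi / 2))
    (by rw [hD2int]; linarith)
  -- the remainder
  obtain ⟨G, hGm, hG0, hGH, hGrem⟩ := aux_rem_env ν θ₀ ρ hρ (fun θ x => Real.log (f θ x)) hLmb
    (by filter_upwards [hsm] with x hx; exact hx.2.2.mono hballK) S0 D2 Hbar hS0m hD2m
    (by
      filter_upwards [hsm] with x hx
      have h := aux_taylor (fun t => Real.log (f t x)) θ₀ ρ (Hbar x) (hHbar_nonneg x)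
        (fun t ht => hx.1 t (hball ht)) (fun t ht => hx.2.1 t (hball ht))
        (fun t ht => by
          have h := hHbar_lip x t (hballK ht)
          rw [← hD2x, hsfun] at h
          exact h)
      rw [← hsfun, hD2x] at h
      rw [hS0]
      simp only at h ⊢
      intro t ht
      have h' := h t ht
      rw [hs] at h'
      exact h')
  have hGsub : SubExponentialTail P (fun ω => G (X 0 ω)) := by
    refine aux_subE_mono P _ _ hHbar_subE ?_
    filter_upwards [hXae _ hG0 0, hXae _ hGH 0] with ω h1 h2
    rw [abs_of_nonneg h1, abs_of_nonneg (hHbar_nonneg _)]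
    exact h2
  have hGe := aux_exp_nu P ν (X 0) (hX_meas 0) (hX_law 0) G hGm hGsub
  obtain ⟨aG, haG⟩ : ∃ aG, aG = |∫ x, G x ∂ν| + 1 := ⟨_, rfl⟩
  have haG0 : 0 < aG := by rw [haG]; positivity
  obtain ⟨c2, hc2, hch2⟩ := aux_chernoff P ν X hX_meas hX_indep hX_law G hGm hGe aG
    (by rw [haG]; linarith [le_abs_self (∫ x, G x ∂ν)])
  -- consistency
  have hmax : ∀ (n : ℕ), 1 ≤ n → ∀ ω, ∑ i ∈ Finset.range n, Real.log (f θ₀ (X i ω)) ≤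
      ∑ i ∈ Finset.range n, Real.log (f (θhat n ω) (X i ω)) := by
    intro n hn ω
    have hn' : (0 : ℝ) < 1 / n := by
      have : (0 : ℝ) < n := by exact_mod_cast hn
      positivity
    exact le_of_mul_le_mul_left (hθhat_max n ω θ₀ hθ₀K) hn'
  obtain ⟨ε, hεdef⟩ : ∃ ε, ε = min ρ (IFi / (8 * aG)) := ⟨_, rfl⟩
  have hε0 : 0 < ε := by rw [hεdef]; exact lt_min hρ (by positivity)
  have hερ : ε ≤ ρ := by rw [hεdef]; exact min_le_left _ _
  have hεI : ε ≤ IFi / (8 * aG) := by rw [hεdef]; exact min_le_right _ _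
  have hcons := aux_consistency P ν X hX_meas hX_indep hX_law K hKcpt θ₀ hθ₀K
    (fun θ x => Real.log (f θ x)) hLm H' hH'm c hc hcexp hH'lip hH'0 hKL θhat hθhat_mem hmax
    ε hε0
  have hA1 : AuxExpSmall P (fun n => {ω | (n : ℝ) * (-(IFi / 2)) ≤
      ∑ i ∈ Finset.range n, D2 (X i ω)}) :=
    ⟨1, c1, zero_le_one, hc1, fun n _ => by rw [one_mul]; exact hch1 n⟩
  have hA2 : AuxExpSmall P (fun n => {ω | (n : ℝ) * aG ≤ ∑ i ∈ Finset.range n, G (X i ω)}) :=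
    ⟨1, c2, zero_le_one, hc2, fun n _ => by rw [one_mul]; exact hch2 n⟩
  have hA := (hcons.union hA1).union hA2
  have hB0 : 0 ≤ B := (abs_nonneg _).trans (hB θ₀ hθ₀K)
  refine aux_final P Z (fun n ω => ∑ i ∈ Finset.range n, S0 (X i ω)) ?_ _ hA
    (√IFi * (2 * B)) (8 / √IFi) (Real.exp (σ / 2)) (by positivity) (by positivity)
    (by positivity) ?_ ?_
    (fun m n hm hn => aux_moment P ν X hX_meas hX_indep hX_law S0 hS0m σ hσ m n hm hn)
  · intro n
    have : Z n = fun ω => √(IFi * n) * (θhat n ω - θ₀) := funext fun ω => hZ n ω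
    rw [this]
    have := hθhat_meas n
    fun_prop
  · intro n ω
    rw [hZ, abs_mul, abs_of_nonneg (Real.sqrt_nonneg _), Real.sqrt_mul hIFi_pos.le]
    have h1 : |θhat n ω - θ₀| ≤ 2 * B := by
      have h2 := abs_sub (θhat n ω) θ₀
      have h3 := hB _ (hθhat_mem n ω)
      have h4 := hB _ hθ₀K
      linarith
    calc _ ≤ √IFi * √n * (2 * B) := mul_le_mul_of_nonneg_left h1 (by positivity)
      _ = _ := by ring
  · intro n hn
    have hall : ∀ᵐ ω ∂P, ∀ i, ∀ t ∈ Metric.ball θ₀ ρ, |Real.log (f t (X i ω))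
        - Real.log (f θ₀ (X i ω)) - S0 (X i ω) * (t - θ₀) - D2 (X i ω) * (t - θ₀) ^ 2 / 2| ≤
        G (X i ω) * |t - θ₀| ^ 3 := by
      rw [ae_all_iff]
      exact hXae _ hGrem
    filter_upwards [hall] with ω hω hnot
    simp only [Set.mem_union, Set.mem_ofPred_eq, not_or, not_le] at hnot
    obtain ⟨⟨hn1, hn2⟩, hn3⟩ := hnot
    have hin : θhat n ω ∈ Metric.ball θ₀ ρ := by
      rw [Metric.mem_ball, Real.dist_eq]
      exact hn1.trans_le hερ
    rw [hZ]
    refine aux_det IFi n _ _ _ _ aG ε hIFi_pos (by exact_mod_cast hn) haG0 hεI ?_ hn2.le hn3.le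
      hn1.le
    have h1 : ∑ i ∈ Finset.range n, (Real.log (f (θhat n ω) (X i ω)) - Real.log (f θ₀ (X i ω))) ≤
        ∑ i ∈ Finset.range n, (S0 (X i ω) * (θhat n ω - θ₀)
          + D2 (X i ω) * ((θhat n ω - θ₀) ^ 2 / 2) + G (X i ω) * |θhat n ω - θ₀| ^ 3) := by
      refine Finset.sum_le_sum fun i _ => ?_
      have := (le_abs_self _).trans (hω i _ hin)
      linarith
    rw [Finset.sum_sub_distrib, Finset.sum_add_distrib, Finset.sum_add_distrib,
      ← Finset.sum_mul, ← Finset.sum_mul, ← Finset.sum_mul] at h1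
    have h2 := hmax n hn ω
    rw [mul_div_assoc]
    linarith
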